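/- Let r ≥ 2. Realize so_{2r}(ℂ) = {X ∈ gl_{2r}(ℂ) : Xᵀ·J + J·X = 0}, where J is the block matrix [[0, I_r],[I_r, 0]], and let O_J(ℂ) = {g ∈ GL_{2r}(ℂ) : gᵀ·J·g = J}. Let h₀ = [[I_r, 0],[0, −I_r]] ∈ so_{2r}(ℂ), so h₀² = I_{2r}. Then the Zariski closure in so_{2r}(ℂ) of the cone C = {t·u·h₀·u⁻¹ : t ∈ ℂ∖{0}, u ∈ O_J(ℂ)} equals C ∪ {X ∈ so_{2r}(ℂ) : X² = 0}; equivalently, the Zariski closure of {X ∈ so_{2r}(ℂ) : X² is a nonzero scalar multiple of I_{2r}} is {X ∈ so_{2r}(ℂ) : X² is a scalar multiple of I_{2r}}. -/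

import Mathlib

open Matrix

noncomputable section

/-- A subset of the space of square complex matrices is Zariski closed if it is the
common zero locus of a family of polynomials in the matrix entries. -/
def zclosed {ι : Type} (S : Set (Matrix ι ι ℂ)) : Prop :=
  ∃ T : Set (MvPolynomial (ι × ι) ℂ),
    S = {X | ∀ p ∈ T, MvPolynomial.eval (fun q => X q.1 q.2) p = 0}

/-- The Zariski closure of a set of matrices. -/
def zclosure {ι : Type} (S : Set (Matrix ι ι ℂ)) : Set (Matrix ι ι ℂ) :=
  ⋂₀ {C | zclosed C ∧ S ⊆ C}


/-- An isotropic subspace of less than half dimension extends. -/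
theorem iso_step {V : Type} [AddCommGroup V] [Module ℂ V] [FiniteDimensional ℂ V]
    (B : LinearMap.BilinForm ℂ V) (hB : B.Nondegenerate) (hs : ∀ x y, B x y = B y x)
    (r : ℕ) (hV : Module.finrank ℂ V = 2 * r) (W : Submodule ℂ V)
    (hW : ∀ x ∈ W, ∀ y ∈ W, B x y = 0) (hlt : Module.finrank ℂ W < r) :
    ∃ W' : Submodule ℂ V, W ≤ W' ∧ (∀ x ∈ W', ∀ y ∈ W', B x y = 0) ∧
      Module.finrank ℂ W < Module.finrank ℂ W' := by
  have ho := LinearMap.BilinForm.finrank_orthogonal hB W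
  have key : ∃ v, v ∈ B.orthogonal W ∧ v ∉ W ∧ B v v = 0 := by
    have h1 : ∃ x ∈ B.orthogonal W, x ∉ W := by
      by_contra! h
      have := Submodule.finrank_mono (show B.orthogonal W ≤ W from h)
      omega
    obtain ⟨x, hx, hxW⟩ := h1
    have h2 : ∃ y ∈ B.orthogonal W, y ∉ W ⊔ Submodule.span ℂ {x} := by
      by_contra! h
      have h3 := Submodule.finrank_mono (show B.orthogonal W ≤ _ from h)
      have h4 := Submodule.finrank_add_le_finrank_add_finrank W (Submodule.span ℂ {x})
      have h5 := finrank_span_le_card (R := ℂ) ({x} : Set V)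
      simp at h5
      omega
    obtain ⟨y, hy, hyW⟩ := h2
    by_cases hxx : B x x = 0
    · exact ⟨x, hx, hxW, hxx⟩
    obtain ⟨s, hs'⟩ := IsAlgClosed.exists_eq_mul_self (discrim (B x x) (2 * B x y) (B y y))
    obtain ⟨t, ht⟩ := exists_quadratic_eq_zero hxx ⟨s, hs'⟩
    refine ⟨y + t • x, Submodule.add_mem _ hy (Submodule.smul_mem _ _ hx), ?_, ?_⟩
    · intro hm
      apply hyW
      have : y = (y + t • x) + (-t) • x := by simp
      rw [this]
      exact Submodule.add_mem_sup hm (Submodule.smul_mem _ _ (Submodule.mem_span_singleton_self x))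
    · have := hs y x
      simp only [map_add, LinearMap.add_apply, map_smul, LinearMap.smul_apply, smul_eq_mul, this]
      linear_combination ht
  obtain ⟨v, hv, hvW, hvv⟩ := key
  refine ⟨W ⊔ Submodule.span ℂ {v}, le_sup_left, ?_, ?_⟩
  · intro x hx y hy
    obtain ⟨a, ha, b, hb, rfl⟩ := Submodule.mem_sup.1 hx
    obtain ⟨c, hc, d, hd, rfl⟩ := Submodule.mem_sup.1 hy
    obtain ⟨β, rfl⟩ := Submodule.mem_span_singleton.1 hb
    obtain ⟨δ, rfl⟩ := Submodule.mem_span_singleton.1 hd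
    have e1 : B a v = 0 := hv a ha
    have e2 : B v c = 0 := by rw [hs]; exact hv c hc
    simp [hW a ha c hc, e1, e2, hvv]
  · apply Submodule.finrank_lt_finrank_of_lt
    refine lt_of_le_of_ne le_sup_left fun h => hvW ?_
    rw [h]
    exact Submodule.mem_sup_right (Submodule.mem_span_singleton_self v)

theorem iso_le {V : Type} [AddCommGroup V] [Module ℂ V] [FiniteDimensional ℂ V]
    (B : LinearMap.BilinForm ℂ V) (hB : B.Nondegenerate)
    (r : ℕ) (hV : Module.finrank ℂ V = 2 * r) (W : Submodule ℂ V)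
    (hW : ∀ x ∈ W, ∀ y ∈ W, B x y = 0) : Module.finrank ℂ W ≤ r := by
  have ho := LinearMap.BilinForm.finrank_orthogonal hB W
  have := Submodule.finrank_mono (show W ≤ B.orthogonal W from fun x hx y hy => hW y hy x hx)
  omega

theorem lag_exists {V : Type} [AddCommGroup V] [Module ℂ V] [FiniteDimensional ℂ V]
    (B : LinearMap.BilinForm ℂ V) (hB : B.Nondegenerate) (hs : ∀ x y, B x y = B y x)
    (r : ℕ) (hV : Module.finrank ℂ V = 2 * r) (n : ℕ) : ∀ (W : Submodule ℂ V),
    (∀ x ∈ W, ∀ y ∈ W, B x y = 0) → r - Module.finrank ℂ W = n →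
    ∃ L : Submodule ℂ V, W ≤ L ∧ (∀ x ∈ L, ∀ y ∈ L, B x y = 0) ∧ Module.finrank ℂ L = r := by
  induction n using Nat.strong_induction_on with
  | _ n ih =>
    intro W hW hn
    rcases (iso_le B hB r hV W hW).lt_or_eq with h | h
    · obtain ⟨W', h1, h2, h3⟩ := iso_step B hB hs r hV W hW h
      obtain ⟨L, h4, h5⟩ := ih (r - Module.finrank ℂ W') (by omega) W' h2 rfl
      exact ⟨L, h1.trans h4, h5⟩
    · exact ⟨W, le_rfl, hW, h⟩

theorem frame_exists {ι : Type} [Fintype ι] [DecidableEq ι] (r : ℕ) (L : Submodule ℂ (ι → ℂ))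
    (hL : Module.finrank ℂ L = r) :
    ∃ (P : Matrix ι (Fin r) ℂ) (P' : Matrix (Fin r) ι ℂ), P' * P = 1 ∧ (∀ v, P *ᵥ v ∈ L) ∧
      ∀ x ∈ L, P *ᵥ (P' *ᵥ x) = x := by
  have e : (Fin r → ℂ) ≃ₗ[ℂ] L := LinearEquiv.ofFinrankEq _ _ (by simp [hL])
  let f : (Fin r → ℂ) →ₗ[ℂ] (ι → ℂ) := L.subtype ∘ₗ e.toLinearMap
  have hf : LinearMap.ker f = ⊥ := by
    rw [LinearMap.ker_eq_bot]
    exact L.injective_subtype.comp e.injective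
  obtain ⟨g, hg⟩ := f.exists_leftInverse_of_injective hf
  refine ⟨LinearMap.toMatrix' f, LinearMap.toMatrix' g, ?_, ?_, ?_⟩
  · rw [← LinearMap.toMatrix'_comp, hg, LinearMap.toMatrix'_id]
  · intro v
    rw [LinearMap.toMatrix'_mulVec]
    exact (e v).2
  · intro x hx
    rw [LinearMap.toMatrix'_mulVec, LinearMap.toMatrix'_mulVec]
    have : x = f (e.symm ⟨x, hx⟩) := by simp [f]
    rw [this]
    have := LinearMap.congr_fun hg (e.symm ⟨x, hx⟩)
    simp only [LinearMap.comp_apply, LinearMap.id_apply] at this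
    rw [this]

/-- the split form -/
def JJ (r : ℕ) : Matrix (Fin r ⊕ Fin r) (Fin r ⊕ Fin r) ℂ := Matrix.fromBlocks 0 1 1 0

def HH (r : ℕ) : Matrix (Fin r ⊕ Fin r) (Fin r ⊕ Fin r) ℂ := Matrix.fromBlocks 1 0 0 (-1)

theorem JJ_sq (r : ℕ) : JJ r * JJ r = 1 := by
  simp [JJ, Matrix.fromBlocks_multiply]

theorem JJ_tr (r : ℕ) : (JJ r)ᵀ = JJ r := by
  simp [JJ, Matrix.fromBlocks_transpose]

theorem HH_sq (r : ℕ) : HH r * HH r = 1 := by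
  simp [HH, Matrix.fromBlocks_multiply]

theorem HH_so (r : ℕ) : (HH r)ᵀ * JJ r + JJ r * HH r = 0 := by
  simp [HH, JJ, Matrix.fromBlocks_multiply, Matrix.fromBlocks_transpose, Matrix.fromBlocks_add]

theorem BJ_nondeg (r : ℕ) : (Matrix.toBilin' (JJ r)).Nondegenerate := by
  apply LinearMap.BilinForm.nondegenerate_toBilin'_of_det_ne_zero'
  intro h
  have := congrArg Matrix.det (JJ_sq r)
  simp [h] at this

theorem BJ_symm (r : ℕ) (x y) : Matrix.toBilin' (JJ r) x y = Matrix.toBilin' (JJ r) y x := by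
  rw [Matrix.toBilin'_apply', Matrix.toBilin'_apply', Matrix.dotProduct_mulVec,
    ← Matrix.mulVec_transpose, JJ_tr, dotProduct_comm]

theorem BJ_fin (r : ℕ) : Module.finrank ℂ (Fin r ⊕ Fin r → ℂ) = 2 * r := by
  simp; ring

theorem iso_mat (r : ℕ) {n m : Type} [Fintype n] [Fintype m] [DecidableEq n] [DecidableEq m]
    (P : Matrix (Fin r ⊕ Fin r) n ℂ) (Q : Matrix (Fin r ⊕ Fin r) m ℂ)
    (h : ∀ v w, Matrix.toBilin' (JJ r) (P *ᵥ v) (Q *ᵥ w) = 0) : Pᵀ * JJ r * Q = 0 := by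
  ext i j
  have := h (Pi.single i 1) (Pi.single j 1)
  rw [Matrix.toBilin'_apply', Matrix.dotProduct_mulVec, Matrix.dotProduct_mulVec] at this
  rw [← Matrix.vecMul_transpose, Matrix.vecMul_vecMul, Matrix.vecMul_vecMul] at this
  simpa [Matrix.mul_assoc] using this

theorem so_adj (r : ℕ) (Y : Matrix (Fin r ⊕ Fin r) (Fin r ⊕ Fin r) ℂ)
    (hY : Yᵀ * JJ r + JJ r * Y = 0) (x y) :
    Matrix.toBilin' (JJ r) (Y *ᵥ x) y = - Matrix.toBilin' (JJ r) x (Y *ᵥ y) := by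
  rw [Matrix.toBilin'_apply', Matrix.toBilin'_apply', ← Matrix.vecMul_transpose,
    ← Matrix.dotProduct_mulVec, Matrix.mulVec_mulVec, Matrix.mulVec_mulVec,
    eq_neg_of_add_eq_zero_left hY, Matrix.neg_mulVec, dotProduct_neg]

/-- assembling the orthogonal matrix -/
theorem cols_orth (r : ℕ) (P Q : Matrix (Fin r ⊕ Fin r) (Fin r) ℂ)
    (h1 : Pᵀ * JJ r * P = 0) (h2 : Pᵀ * JJ r * Q = 1) (h3 : Qᵀ * JJ r * Q = 0) :
    (Matrix.fromCols P Q)ᵀ * JJ r * Matrix.fromCols P Q = JJ r := by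
  have h4 : Qᵀ * JJ r * P = 1 := by
    have := congrArg Matrix.transpose h2
    simpa [Matrix.transpose_mul, JJ_tr, Matrix.mul_assoc] using this
  rw [Matrix.transpose_fromCols, Matrix.fromRows_mul, Matrix.fromRows_mul_fromCols, h1, h2, h3, h4]
  rfl

theorem orth_inv (r : ℕ) (u : Matrix (Fin r ⊕ Fin r) (Fin r ⊕ Fin r) ℂ)
    (hu : uᵀ * JJ r * u = JJ r) :
    ∃ g : Matrix.GeneralLinearGroup (Fin r ⊕ Fin r) ℂ,
      (g : Matrix (Fin r ⊕ Fin r) (Fin r ⊕ Fin r) ℂ) = u := by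
  have h : (JJ r * uᵀ * JJ r) * u = 1 := by
    rw [Matrix.mul_assoc, Matrix.mul_assoc, ← Matrix.mul_assoc _ _ u, hu, JJ_sq]
  exact ⟨⟨u, _, mul_eq_one_comm.1 h, h⟩, rfl⟩

theorem orth_so (r : ℕ) (g : Matrix.GeneralLinearGroup (Fin r ⊕ Fin r) ℂ)
    (hu : (g : Matrix (Fin r ⊕ Fin r) (Fin r ⊕ Fin r) ℂ)ᵀ * JJ r * g.1 = JJ r) :
    (g.1 * HH r * g⁻¹.1)ᵀ * JJ r + JJ r * (g.1 * HH r * g⁻¹.1) = 0 := by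
  have hi : g.1 * g⁻¹.1 = 1 := by simp
  have hi' : g⁻¹.1ᵀ * g.1ᵀ = 1 := by rw [← Matrix.transpose_mul, hi, Matrix.transpose_one]
  have e1 : JJ r * g.1 = g⁻¹.1ᵀ * JJ r := by
    calc JJ r * g.1 = (g⁻¹.1ᵀ * g.1ᵀ) * JJ r * g.1 := by rw [hi', Matrix.one_mul]
      _ = g⁻¹.1ᵀ * (g.1ᵀ * JJ r * g.1) := by simp only [Matrix.mul_assoc]
      _ = _ := by rw [hu]
  have e2 : g.1ᵀ * JJ r = JJ r * g⁻¹.1 := by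
    calc g.1ᵀ * JJ r = g.1ᵀ * JJ r * (g.1 * g⁻¹.1) := by rw [hi, Matrix.mul_one]
      _ = (g.1ᵀ * JJ r * g.1) * g⁻¹.1 := by simp only [Matrix.mul_assoc]
      _ = _ := by rw [hu]
  calc (g.1 * HH r * g⁻¹.1)ᵀ * JJ r + JJ r * (g.1 * HH r * g⁻¹.1)
      = g⁻¹.1ᵀ * (HH r)ᵀ * (g.1ᵀ * JJ r) + (JJ r * g.1) * HH r * g⁻¹.1 := by
        simp only [Matrix.transpose_mul, Matrix.mul_assoc]
    _ = g⁻¹.1ᵀ * ((HH r)ᵀ * JJ r + JJ r * HH r) * g⁻¹.1 := by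
        rw [e1, e2]; simp only [Matrix.mul_assoc, Matrix.mul_add, Matrix.add_mul]
    _ = 0 := by rw [HH_so]; simp

theorem conj_sq (r : ℕ) (g : Matrix.GeneralLinearGroup (Fin r ⊕ Fin r) ℂ) :
    (g.1 * HH r * g⁻¹.1) * (g.1 * HH r * g⁻¹.1) = 1 := by
  have hi : g⁻¹.1 * g.1 = 1 := by simp
  have hi' : g.1 * g⁻¹.1 = 1 := by simp
  calc _ = g.1 * (HH r * (g⁻¹.1 * g.1) * HH r) * g⁻¹.1 := by simp only [Matrix.mul_assoc]
    _ = 1 := by rw [hi, Matrix.mul_one, HH_sq, Matrix.mul_one, hi']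

theorem cols_HH (r : ℕ) (P Q : Matrix (Fin r ⊕ Fin r) (Fin r) ℂ) :
    Matrix.fromCols P Q * HH r = Matrix.fromCols P (-Q) := by
  rw [HH, Matrix.fromCols_mul_fromBlocks]; simp

/-- involutions in so are conjugate to the standard one -/
theorem invol_conj (r : ℕ) (Y : Matrix (Fin r ⊕ Fin r) (Fin r ⊕ Fin r) ℂ)
    (hY : Yᵀ * JJ r + JJ r * Y = 0) (hY2 : Y * Y = 1) :
    ∃ g : Matrix.GeneralLinearGroup (Fin r ⊕ Fin r) ℂ, g.1ᵀ * JJ r * g.1 = JJ r ∧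
      Y = g.1 * HH r * g⁻¹.1 := by
  let f := Matrix.mulVecLin Y
  let Vp := LinearMap.ker (Matrix.mulVecLin (Y - 1))
  let Vm := LinearMap.ker (Matrix.mulVecLin (Y + 1))
  have mp : ∀ x, x ∈ Vp ↔ Y *ᵥ x = x := fun x => by
    simp [Vp, Matrix.sub_mulVec, sub_eq_zero]
  have mm : ∀ x, x ∈ Vm ↔ Y *ᵥ x = -x := fun x => by
    simp [Vm, Matrix.add_mulVec, add_eq_zero_iff_eq_neg]
  have ip : ∀ x ∈ Vp, ∀ y ∈ Vp, Matrix.toBilin' (JJ r) x y = 0 := by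
    intro x hx y hy
    have := so_adj r Y hY x y
    rw [(mp x).1 hx, (mp y).1 hy] at this
    linear_combination this / 2
  have im : ∀ x ∈ Vm, ∀ y ∈ Vm, Matrix.toBilin' (JJ r) x y = 0 := by
    intro x hx y hy
    have := so_adj r Y hY x y
    rw [(mm x).1 hx, (mm y).1 hy, map_neg, map_neg, LinearMap.neg_apply] at this
    linear_combination - this / 2
  have dp := iso_le _ (BJ_nondeg r) r (BJ_fin r) Vp ip
  have dm := iso_le _ (BJ_nondeg r) r (BJ_fin r) Vm im
  have hYY : ∀ x, Y *ᵥ (Y *ᵥ x) = x := fun x => by rw [Matrix.mulVec_mulVec, hY2, Matrix.one_mulVec]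
  have htop : Vp ⊔ Vm = ⊤ := by
    rw [eq_top_iff]
    intro x _
    have : x = (1/2 : ℂ) • (x + Y *ᵥ x) + (1/2 : ℂ) • (x - Y *ᵥ x) := by
      module
    rw [this]
    apply Submodule.add_mem_sup <;> apply Submodule.smul_mem
    · rw [mp, Matrix.mulVec_add, hYY, add_comm]
    · rw [mm, Matrix.mulVec_sub, hYY, neg_sub]
  have dsum := Submodule.finrank_add_le_finrank_add_finrank Vp Vm
  rw [htop, finrank_top, BJ_fin] at dsum
  obtain ⟨P, P', hPP, hPL, -⟩ := frame_exists r Vp (by omega)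
  have hYP : Y * P = P := by
    apply Matrix.ext_of_mulVec_single
    intro i
    rw [← Matrix.mulVec_mulVec]
    exact (mp _).1 (hPL _)
  let Q : Matrix (Fin r ⊕ Fin r) (Fin r) ℂ := (1/2 : ℂ) • ((1 - Y) * (JJ r * P'ᵀ))
  have hYQ : Y * Q = -Q := by
    simp only [Q, Matrix.mul_smul, ← Matrix.mul_assoc, Matrix.mul_sub, hY2, Matrix.mul_one]
    rw [← smul_neg, ← Matrix.neg_mul, ← Matrix.neg_mul, neg_sub]
  have h1 : Pᵀ * JJ r * P = 0 := iso_mat r P P fun v w => ip _ (hPL v) _ (hPL w)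
  have h3 : Qᵀ * JJ r * Q = 0 := iso_mat r Q Q fun v w => by
    apply im <;> rw [mm, Matrix.mulVec_mulVec, hYQ, Matrix.neg_mulVec]
  have hJY : JJ r * Y = - (Yᵀ * JJ r) := eq_neg_of_add_eq_zero_right hY
  have h2 : Pᵀ * JJ r * Q = 1 := by
    have e : Pᵀ * JJ r * (1 - Y) = (2 : ℂ) • (Pᵀ * JJ r) := by
      rw [Matrix.mul_sub, Matrix.mul_assoc _ _ Y, hJY, Matrix.mul_neg, ← Matrix.mul_assoc,
        ← Matrix.transpose_mul, hYP, Matrix.mul_one, two_smul, sub_neg_eq_add]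
    simp only [Q, Matrix.mul_smul]
    rw [← Matrix.mul_assoc, e, Matrix.smul_mul, smul_smul, Matrix.mul_assoc,
      ← Matrix.mul_assoc (JJ r), JJ_sq, Matrix.one_mul, ← Matrix.transpose_mul, hPP]
    simp
  have hu := cols_orth r P Q h1 h2 h3
  obtain ⟨g, hg⟩ := orth_inv r _ hu
  refine ⟨g, by rw [hg]; exact hu, ?_⟩
  have hi : g.1 * g⁻¹.1 = 1 := by simp
  have hc : Y * g.1 = g.1 * HH r := by
    rw [hg, cols_HH, Matrix.mul_fromCols, hYP, hYQ]
  rw [← hc, Matrix.mul_assoc, hi, Matrix.mul_one]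

/-- square-zero elements anticommute with a conjugate of the standard involution -/
theorem nilp_anti (r : ℕ) (X : Matrix (Fin r ⊕ Fin r) (Fin r ⊕ Fin r) ℂ)
    (hX : Xᵀ * JJ r + JJ r * X = 0) (hX2 : X * X = 0) :
    ∃ h : Matrix (Fin r ⊕ Fin r) (Fin r ⊕ Fin r) ℂ, hᵀ * JJ r + JJ r * h = 0 ∧ h * h = 1 ∧
      h * X + X * h = 0 := by
  have iW : ∀ x ∈ LinearMap.range (Matrix.mulVecLin X), ∀ y ∈ LinearMap.range (Matrix.mulVecLin X),
      Matrix.toBilin' (JJ r) x y = 0 := by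
    rintro _ ⟨x, rfl⟩ _ ⟨y, rfl⟩
    rw [Matrix.mulVecLin_apply, Matrix.mulVecLin_apply, so_adj r X hX, Matrix.mulVec_mulVec, hX2]
    simp
  obtain ⟨L, hWL, iL, dL⟩ := lag_exists _ (BJ_nondeg r) (BJ_symm r) r (BJ_fin r) _ _ iW rfl
  obtain ⟨P, P', hPP, hPL, hLP⟩ := frame_exists r L dL
  have hXL : ∀ x, X *ᵥ x ∈ L := fun x => hWL ⟨x, rfl⟩
  have h1 : Pᵀ * JJ r * P = 0 := iso_mat r P P fun v w => iL _ (hPL v) _ (hPL w)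
  have hXP : X * P = 0 := by
    have h5 : Xᵀ * JJ r * P = 0 := iso_mat r X P fun v w => iL _ (hXL v) _ (hPL w)
    rw [eq_neg_of_add_eq_zero_left hX, Matrix.neg_mul, neg_eq_zero, Matrix.mul_assoc] at h5
    have h6 := congrArg (JJ r * ·) h5
    simpa [← Matrix.mul_assoc, JJ_sq] using h6
  have hPX : P * (P' * X) = X := by
    apply Matrix.ext_of_mulVec_single
    intro i
    rw [← Matrix.mulVec_mulVec, ← Matrix.mulVec_mulVec]
    exact hLP _ (hXL _)
  let Q0 : Matrix (Fin r ⊕ Fin r) (Fin r) ℂ := JJ r * P'ᵀ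
  have hPQ0 : Pᵀ * JJ r * Q0 = 1 := by
    simp only [Q0]
    rw [Matrix.mul_assoc, ← Matrix.mul_assoc (JJ r), JJ_sq, Matrix.one_mul, ← Matrix.transpose_mul,
      hPP, Matrix.transpose_one]
  have hQ0P : Q0ᵀ * JJ r * P = 1 := by
    have := congrArg Matrix.transpose hPQ0
    simpa [Matrix.transpose_mul, JJ_tr, Matrix.mul_assoc] using this
  let G : Matrix (Fin r) (Fin r) ℂ := Q0ᵀ * JJ r * Q0
  have hG : Gᵀ = G := by
    simp [G, Matrix.transpose_mul, JJ_tr, Matrix.mul_assoc]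
  let Q := Q0 - (1/2 : ℂ) • (P * G)
  have h2 : Pᵀ * JJ r * Q = 1 := by
    simp only [Q, Matrix.mul_sub, Matrix.mul_smul, ← Matrix.mul_assoc _ P, h1, hPQ0]
    simp
  have h3 : Qᵀ * JJ r * Q = 0 := by
    have e : Qᵀ = Q0ᵀ - (1/2 : ℂ) • (G * Pᵀ) := by
      simp only [Q, Matrix.transpose_sub, Matrix.transpose_smul, Matrix.transpose_mul, hG]
    rw [e, Matrix.mul_assoc, Matrix.sub_mul, Matrix.smul_mul, Matrix.mul_assoc G,
      ← Matrix.mul_assoc Pᵀ, h2, Matrix.mul_one, ← Matrix.mul_assoc]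
    simp only [Q, Matrix.mul_sub, Matrix.mul_smul, ← Matrix.mul_assoc _ P, hQ0P, Matrix.one_mul]
    change G - (1/2 : ℂ) • G - (1/2 : ℂ) • G = 0
    module
  have hu := cols_orth r P Q h1 h2 h3
  obtain ⟨g, hg⟩ := orth_inv r _ hu
  have hu' : g.1ᵀ * JJ r * g.1 = JJ r := by rw [hg]; exact hu
  refine ⟨g.1 * HH r * g⁻¹.1, orth_so r g hu', conj_sq r g, ?_⟩
  have hi : g⁻¹.1 * g.1 = 1 := by simp
  have hi' : g.1 * g⁻¹.1 = 1 := by simp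
  -- X g = - X g H and h X = X
  have a1 : X * g.1 * HH r = - (X * g.1) := by
    rw [hg, Matrix.mul_assoc, cols_HH, Matrix.mul_fromCols, Matrix.mul_fromCols, hXP,
      Matrix.fromCols_neg, Matrix.mul_neg, neg_zero]
  have a2 : g.1 * HH r * g⁻¹.1 * P = P := by
    have b1 : g.1 * HH r * g⁻¹.1 * g.1 = g.1 * HH r := by
      rw [Matrix.mul_assoc, hi, Matrix.mul_one]
    have b2 : g.1 * HH r * g⁻¹.1 * Matrix.fromCols P Q = Matrix.fromCols P (-Q) := by
      rw [← cols_HH, ← hg, b1]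
    rw [Matrix.mul_fromCols] at b2
    exact (Matrix.fromCols_inj b2).1
  have a3 : g.1 * HH r * g⁻¹.1 * X = X := by
    rw [← hPX, ← Matrix.mul_assoc, a2]
  have a4 : X * (g.1 * HH r * g⁻¹.1) = - X := by
    rw [← Matrix.mul_assoc, ← Matrix.mul_assoc, a1, Matrix.neg_mul, Matrix.mul_assoc, hi',
      Matrix.mul_one]
  rw [a3, a4, add_neg_cancel]

theorem so_scalar_closed {ι : Type} [Fintype ι] [DecidableEq ι] [Nonempty ι] (J : Matrix ι ι ℂ) :
    zclosed {X : Matrix ι ι ℂ | X ∈ {X : Matrix ι ι ℂ | Xᵀ * J + J * X = 0} ∧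
      ∃ c : ℂ, X * X = c • (1 : Matrix ι ι ℂ)} := by
  obtain ⟨i₀⟩ := ‹Nonempty ι›
  let G : Matrix ι ι (MvPolynomial (ι × ι) ℂ) := Matrix.of fun i j => MvPolynomial.X (i, j)
  let J' : Matrix ι ι (MvPolynomial (ι × ι) ℂ) := J.map MvPolynomial.C
  let F1 := Gᵀ * J' + J' * G
  let F2 := G * G - (G * G) i₀ i₀ • (1 : Matrix ι ι (MvPolynomial (ι × ι) ℂ))
  refine ⟨{p | ∃ i j, p = F1 i j ∨ p = F2 i j}, ?_⟩
  have ev1 : ∀ (X : Matrix ι ι ℂ) i j, MvPolynomial.eval (fun q : ι × ι => X q.1 q.2) (F1 i j) =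
      (Xᵀ * J + J * X) i j := by
    intro X i j
    simp [F1, G, J', Matrix.mul_apply]
  have ev2 : ∀ (X : Matrix ι ι ℂ) i j, MvPolynomial.eval (fun q : ι × ι => X q.1 q.2) (F2 i j) =
      (X * X - (X * X) i₀ i₀ • (1 : Matrix ι ι ℂ)) i j := by
    intro X i j
    by_cases h : i = j <;> simp [F2, G, Matrix.mul_apply, Matrix.one_apply, h]
  ext X
  simp only [Set.mem_setOf_eq]
  constructor
  · rintro ⟨h1, c, h2⟩ p ⟨i, j, rfl | rfl⟩
    · rw [ev1, h1]; rfl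
    · rw [ev2, h2]
      simp
  · intro h
    refine ⟨?_, (X * X) i₀ i₀, ?_⟩
    · ext i j
      rw [← ev1]
      exact h _ ⟨i, j, Or.inl rfl⟩
    · rw [← sub_eq_zero]
      ext i j
      rw [← ev2]
      exact h _ ⟨i, j, Or.inr rfl⟩

/-- a Zariski closed set containing all points but one of an affine line contains the line -/
theorem zclosed_line {ι : Type} (S : Set (Matrix ι ι ℂ)) (hS : zclosed S) (X h : Matrix ι ι ℂ)
    (H : ∀ s : ℂ, s ≠ 0 → X + s • h ∈ S) : X ∈ S := by
  obtain ⟨T, rfl⟩ := hS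
  intro p hp
  let f : ℂ → ℂ := fun s => MvPolynomial.eval (fun q => (X + s • h) q.1 q.2) p
  have hf : Continuous f := by
    apply (MvPolynomial.continuous_eval p).comp
    refine continuous_pi fun q => ?_
    simp only [Matrix.add_apply, Matrix.smul_apply, smul_eq_mul]
    fun_prop
  have : f = fun _ => 0 := by
    apply hf.ext_on (dense_compl_singleton (0 : ℂ)) continuous_const
    intro s hs
    exact H s hs p hp
  have h0 := congrFun this 0
  simpa [f] using h0

theorem stmt_1 (r : ℕ) (hr : 2 ≤ r)
    (J : Matrix (Fin r ⊕ Fin r) (Fin r ⊕ Fin r) ℂ)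
    (hJ : J = Matrix.fromBlocks 0 1 1 0)
    (so : Set (Matrix (Fin r ⊕ Fin r) (Fin r ⊕ Fin r) ℂ))
    (hso : so = {X | Xᵀ * J + J * X = 0})
    (OJ : Set (Matrix.GeneralLinearGroup (Fin r ⊕ Fin r) ℂ))
    (hOJ : OJ = {g : Matrix.GeneralLinearGroup (Fin r ⊕ Fin r) ℂ | (↑g : Matrix (Fin r ⊕ Fin r) (Fin r ⊕ Fin r) ℂ)ᵀ * J * (↑g : Matrix (Fin r ⊕ Fin r) (Fin r ⊕ Fin r) ℂ) = J})
    (h₀ : Matrix (Fin r ⊕ Fin r) (Fin r ⊕ Fin r) ℂ)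
    (hh₀ : h₀ = Matrix.fromBlocks 1 0 0 (-1))
    (C : Set (Matrix (Fin r ⊕ Fin r) (Fin r ⊕ Fin r) ℂ))
    (hC : C = {X | ∃ t : ℂ, t ≠ 0 ∧ ∃ u ∈ OJ,
      X = t • ((↑u : Matrix (Fin r ⊕ Fin r) (Fin r ⊕ Fin r) ℂ) * h₀ * (↑u⁻¹ : Matrix (Fin r ⊕ Fin r) (Fin r ⊕ Fin r) ℂ))}) :
    zclosure C = C ∪ {X ∈ so | X * X = 0} ∧
    zclosure {X ∈ so | ∃ c : ℂ, c ≠ 0 ∧ X * X = c • (1 : Matrix (Fin r ⊕ Fin r) (Fin r ⊕ Fin r) ℂ)}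
      = {X ∈ so | ∃ c : ℂ, X * X = c • (1 : Matrix (Fin r ⊕ Fin r) (Fin r ⊕ Fin r) ℂ)} := by
  subst hJ hso hOJ hh₀
  have hne : Nonempty (Fin r ⊕ Fin r) := ⟨Sum.inl ⟨0, by omega⟩⟩
  have hcl := so_scalar_closed (JJ r)
  have hCA : C = {X | X ∈ {X | Xᵀ * JJ r + JJ r * X = 0} ∧
      ∃ c : ℂ, c ≠ 0 ∧ X * X = c • (1 : Matrix (Fin r ⊕ Fin r) (Fin r ⊕ Fin r) ℂ)} := by
    rw [hC]
    ext X
    constructor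
    · rintro ⟨t, ht, u, hu, rfl⟩
      have e1 := orth_so r u hu
      have e2 := conj_sq r u
      refine ⟨?_, t * t, mul_ne_zero ht ht, ?_⟩
      · change (t • (u.1 * HH r * u⁻¹.1))ᵀ * JJ r + JJ r * (t • (u.1 * HH r * u⁻¹.1)) = 0
        rw [Matrix.transpose_smul, Matrix.smul_mul, Matrix.mul_smul, ← smul_add, e1, smul_zero]
      · change (t • (u.1 * HH r * u⁻¹.1)) * (t • (u.1 * HH r * u⁻¹.1)) = _
        rw [Matrix.smul_mul, Matrix.mul_smul, e2, smul_smul]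
    · rintro ⟨h1, c, hc, h2⟩
      obtain ⟨t, rfl⟩ := IsAlgClosed.exists_eq_mul_self c
      have ht : t ≠ 0 := fun h => hc (by simp [h])
      have h1' : Xᵀ * JJ r + JJ r * X = 0 := h1
      obtain ⟨g, hg, hX⟩ := invol_conj r (t⁻¹ • X)
        (by rw [Matrix.transpose_smul, Matrix.smul_mul, Matrix.mul_smul, ← smul_add, h1', smul_zero])
        (by rw [Matrix.smul_mul, Matrix.mul_smul, h2, smul_smul, smul_smul]
            rw [show t⁻¹ * t⁻¹ * (t * t) = 1 by field_simp, one_smul])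
      refine ⟨t, ht, g, hg, ?_⟩
      change X = t • (g.1 * HH r * g⁻¹.1)
      rw [← hX, smul_smul, mul_inv_cancel₀ ht, one_smul]
  have main : zclosure {X | X ∈ {X | Xᵀ * JJ r + JJ r * X = 0} ∧
      ∃ c : ℂ, c ≠ 0 ∧ X * X = c • (1 : Matrix (Fin r ⊕ Fin r) (Fin r ⊕ Fin r) ℂ)} =
      {X | X ∈ {X | Xᵀ * JJ r + JJ r * X = 0} ∧
      ∃ c : ℂ, X * X = c • (1 : Matrix (Fin r ⊕ Fin r) (Fin r ⊕ Fin r) ℂ)} := by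
    apply Set.Subset.antisymm
    · apply Set.sInter_subset_of_mem
      exact ⟨hcl, fun X hX => ⟨hX.1, hX.2.imp fun c h => h.2⟩⟩
    · rintro X ⟨h1, c, h2⟩ S ⟨hS, hsub⟩
      by_cases hc : c = 0
      · rw [hc, zero_smul] at h2
        obtain ⟨h, b1, b2, b3⟩ := nilp_anti r X h1 h2
        have h1' : Xᵀ * JJ r + JJ r * X = 0 := h1
        refine zclosed_line S hS X h fun s hs => hsub ⟨?_, s * s, mul_ne_zero hs hs, ?_⟩
        · change (X + s • h)ᵀ * JJ r + JJ r * (X + s • h) = 0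
          rw [Matrix.transpose_add, Matrix.transpose_smul, Matrix.add_mul, Matrix.mul_add,
            Matrix.smul_mul, Matrix.mul_smul, add_add_add_comm, h1', ← smul_add, b1]
          simp
        · calc (X + s • h) * (X + s • h) = X * X + s • (h * X + X * h) + (s * s) • (h * h) := by
                simp only [Matrix.mul_add, Matrix.add_mul, Matrix.smul_mul, Matrix.mul_smul,
                  smul_add, smul_smul]
                abel
            _ = _ := by rw [h2, b3, b2]; simp
      · exact hsub ⟨h1, c, hc, h2⟩
  refine ⟨?_, main⟩
  rw [hCA]
  refine main.trans ?_
  ext X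
  constructor
  · rintro ⟨h1, c, h2⟩
    by_cases hc : c = 0
    · right
      exact ⟨h1, by rw [h2, hc, zero_smul]⟩
    · left
      exact ⟨h1, c, hc, h2⟩
  · rintro (⟨h1, c, -, h2⟩ | ⟨h1, h2⟩)
    · exact ⟨h1, c, h2⟩
    · exact ⟨h1, 0, by rw [h2, zero_smul]⟩
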